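/- arXiv:2008.08380 — 3 statements merged into one kernel-verified Lean document; each statement's English description precedes it below -/
import Mathlib

section
/- There exist absolute constants c₁, c₂, c₃, c₄, c₅ > 0 such that the following holds. Let p ≥ 1, let f be a nonnegative measurable function of a random variable X such that E f(X)^p < ∞ and the distribution of f(X) is atomless. Let N ∈ ℕ, let c₁/N < Δ ≤ 1/2, and let x_1,…,x_N be points such that the sample satisfies Properties (1)–(3) for f with constants λ = 1/2, C = 2 and Δ. Set θ = c₂Δ and Λ = Q_{1−c₃Δ}(f). Then (1/N)·Σ_{j ≥ θN} (f(x_i)^p)_j^* ≥ E f(X)^p − c₄·( E_{Λ,p}(f) + E[f(X)^p · 1_{f(X) > Q_{1−c₅Δ}(f)}] ), where the left-hand side is the sum of the values f(x_i)^p after discarding the ⌈θN⌉ largest ones, divided by N. -/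
open MeasureTheory Real

/-- The trimmed mean: discard the `⌈θN⌉` largest values of `z` and average the rest. -/
noncomputable def trimmedMean {N : ℕ} (z : Fin N → ℝ) (θ : ℝ) : ℝ :=
  (N : ℝ)⁻¹ * ∑ j ∈ Finset.univ.filter
      (fun j : Fin N => (j : ℕ) < N - Nat.ceil (θ * N)), z (Tuple.sort z j)

/-- Empirical measure of a set along the sample `x`. -/
noncomputable def empP {Ω : Type*} {N : ℕ} (x : Fin N → Ω) (s : Set Ω) : ℝ :=
  (N : ℝ)⁻¹ * ∑ i : Fin N, s.indicator (fun _ => (1 : ℝ)) (x i)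

/-- Properties (1)-(3) of the sample `x` for the function `f`, with constants `lam`, `C`, `Δ`. -/
def SatisfiesProps {Ω : Type*} [MeasurableSpace Ω] (μ : Measure Ω) (f : Ω → ℝ)
    {N : ℕ} (x : Fin N → Ω) (lam C Δ : ℝ) : Prop :=
  (∀ t : ℝ, 0 < t → Δ ≤ (μ {ω | t < f ω}).toReal →
    |empP x {ω | t < f ω} / (μ {ω | t < f ω}).toReal - 1| ≤ lam) ∧
  (∀ (j : ℕ) (t : ℝ), 0 < t → Δ ≤ 2 ^ (-(j : ℝ)) * (μ {ω | t < f ω}).toReal →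
    |empP x {ω | t < f ω} / (μ {ω | t < f ω}).toReal - 1| ≤ 2 ^ (-(j : ℝ) / 2)) ∧
  (∀ I : Set ℝ, I.OrdConnected →
    empP x {ω | f ω ∈ I} ≤ 3 / 2 * (μ {ω | f ω ∈ I}).toReal + C * Δ)

/-- `Q_{1-η}(f) = inf {t : P(f > t) < η}`. -/
noncomputable def quant {Ω : Type*} [MeasurableSpace Ω] (μ : Measure Ω) (f : Ω → ℝ)
    (η : ℝ) : ℝ :=
  sInf {t : ℝ | (μ {ω | t < f ω}).toReal < η}

/-- `E_{T,p}(f) = 2√Δ ∫_0^T p t^{p-1} √(P(f>t)) dt`. -/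
noncomputable def errE {Ω : Type*} [MeasurableSpace Ω] (μ : Measure Ω) (f : Ω → ℝ)
    (Δ p T : ℝ) : ℝ :=
  2 * Real.sqrt Δ * ∫ t in (0 : ℝ)..T, p * t ^ (p - 1) * Real.sqrt ((μ {ω | t < f ω}).toReal)

lemma integral_rpow_mul_indicator_Iio {p a T : ℝ} (hp : 1 ≤ p) (ha : 0 ≤ a) (hT : 0 ≤ T) :
    ∫ t in (0 : ℝ)..T, p * t ^ (p - 1) * (Set.Iio a).indicator (fun _ => (1 : ℝ)) t
      = min a T ^ p := by
  have hm : 0 ≤ min a T := le_min ha hT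
  have h1 : ∫ t in (0 : ℝ)..T, p * t ^ (p - 1) * (Set.Iio a).indicator (fun _ => (1 : ℝ)) t
      = ∫ t in (0 : ℝ)..min a T, p * t ^ (p - 1) := by
    rw [intervalIntegral.integral_of_le hT, intervalIntegral.integral_of_le hm]
    have h2 : ∀ t, p * t ^ (p - 1) * (Set.Iio a).indicator (fun _ => (1 : ℝ)) t
        = (Set.Iio a).indicator (fun t => p * t ^ (p - 1)) t := by
      intro t
      by_cases h : t ∈ Set.Iio a <;> simp [h]
    simp_rw [h2]
    rw [setIntegral_indicator measurableSet_Iio, min_comm, ← Set.Ioc_inter_Iic]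
    exact setIntegral_congr_set ((ae_eq_refl _).inter Iio_ae_eq_Iic)
  rw [h1, intervalIntegral.integral_const_mul, integral_rpow (Or.inl (by linarith))]
  rw [sub_add_cancel, Real.zero_rpow (by linarith)]
  field_simp
  ring

lemma intervalIntegrable_rpow_mul {p T : ℝ} (hp : 1 ≤ p) {h : ℝ → ℝ} (hh : Antitone h) :
    IntervalIntegrable (fun t => p * t ^ (p - 1) * h t) volume 0 T := by
  refine hh.intervalIntegrable.continuousOn_mul ?_
  have : Continuous fun t : ℝ => p * t ^ (p - 1) :=
    continuous_const.mul (Real.continuous_rpow_const (by linarith))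
  exact this.continuousOn

lemma antitone_indicator_Iio (a : ℝ) :
    Antitone ((Set.Iio a).indicator (fun _ => (1 : ℝ))) := by
  intro s t hst
  by_cases h : t < a
  · simp [h, lt_of_le_of_lt hst h]
  · simpa [h] using Set.indicator_nonneg (fun _ _ => zero_le_one) s

lemma antitone_measureReal_lt {Ω : Type*} [MeasurableSpace Ω] (μ : Measure Ω)
    [IsFiniteMeasure μ] (f : Ω → ℝ) : Antitone fun t => (μ {ω | t < f ω}).toReal := by
  intro s t hst
  exact ENNReal.toReal_mono (measure_ne_top _ _) (measure_mono fun ω h => lt_of_le_of_lt hst h)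

lemma antitone_empP_lt {Ω : Type*} (f : Ω → ℝ) {N : ℕ} (x : Fin N → Ω) :
    Antitone fun t => empP x {ω | t < f ω} := by
  intro s t hst
  refine mul_le_mul_of_nonneg_left (Finset.sum_le_sum fun i _ => ?_) (by positivity)
  exact antitone_indicator_Iio (f (x i)) hst

lemma integral_min_rpow_eq {Ω : Type*} [MeasurableSpace Ω] (μ : Measure Ω)
    [IsFiniteMeasure μ] {f : Ω → ℝ} (hf : Measurable f) (hf0 : ∀ ω, 0 ≤ f ω) {p T : ℝ}
    (hp : 1 ≤ p) (hT : 0 ≤ T) :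
    ∫ ω, min (f ω) T ^ p ∂μ
      = ∫ t in (0 : ℝ)..T, p * t ^ (p - 1) * (μ {ω | t < f ω}).toReal := by
  have hg : Measurable fun t : ℝ => p * t ^ (p - 1) :=
    (measurable_id.pow_const _).const_mul _
  have hS : MeasurableSet {z : Ω × ℝ | z.2 < f z.1} :=
    measurableSet_lt measurable_snd (hf.comp measurable_fst)
  have hgi : Integrable (fun t : ℝ => p * t ^ (p - 1)) (volume.restrict (Set.Ioc 0 T)) := by
    have := intervalIntegrable_rpow_mul (T := T) hp (h := fun _ => 1) antitone_const
    simpa [IntegrableOn] using (intervalIntegrable_iff_integrableOn_Ioc_of_le hT).1 this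
  have hint : Integrable (Function.uncurry fun (ω : Ω) (t : ℝ) =>
      p * t ^ (p - 1) * (Set.Iio (f ω)).indicator (fun _ => (1 : ℝ)) t)
      (μ.prod (volume.restrict (Set.Ioc 0 T))) := by
    refine ((hgi.comp_snd μ).indicator hS).congr (Filter.Eventually.of_forall ?_)
    rintro ⟨ω, t⟩
    by_cases h : t < f ω <;> simp [Function.uncurry, h]
  simp_rw [← integral_rpow_mul_indicator_Iio hp (hf0 _) hT, intervalIntegral.integral_of_le hT]
  rw [integral_integral_swap hint]
  refine integral_congr_ae (Filter.Eventually.of_forall fun t => ?_)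
  have h1 : ∀ ω, (Set.Iio (f ω)).indicator (fun _ => (1 : ℝ)) t
      = {ω | t < f ω}.indicator (fun _ => (1 : ℝ)) ω := fun ω => rfl
  simp only [h1]
  rw [integral_const_mul, integral_indicator (measurableSet_lt measurable_const hf)]
  simp [Measure.real]

lemma sum_min_rpow_eq {Ω : Type*} {f : Ω → ℝ} (hf0 : ∀ ω, 0 ≤ f ω) {p T : ℝ}
    (hp : 1 ≤ p) (hT : 0 ≤ T) {N : ℕ} (x : Fin N → Ω) :
    (N : ℝ)⁻¹ * ∑ i, min (f (x i)) T ^ p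
      = ∫ t in (0 : ℝ)..T, p * t ^ (p - 1) * empP x {ω | t < f ω} := by
  simp_rw [← integral_rpow_mul_indicator_Iio hp (hf0 _) hT]
  rw [← intervalIntegral.integral_finsetSum fun i _ =>
    intervalIntegrable_rpow_mul hp (antitone_indicator_Iio _),
    ← intervalIntegral.integral_const_mul]
  congr 1
  ext t
  rw [← Finset.mul_sum, empP]
  have h1 : ∀ i, (Set.Iio (f (x i))).indicator (fun _ => (1 : ℝ)) t
      = {ω | t < f ω}.indicator (fun _ => (1 : ℝ)) (x i) := fun i => rfl
  simp only [h1]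
  ring

lemma le_trimmedMean {N : ℕ} {z w : Fin N → ℝ} {θ B : ℝ} (hwz : ∀ i, w i ≤ z i)
    (hwB : ∀ i, w i ≤ B) (hB : 0 ≤ B) (hθ : 0 ≤ θ) :
    (N : ℝ)⁻¹ * ∑ i, w i - (θ + (N : ℝ)⁻¹) * B ≤ trimmedMean z θ := by
  set S := Finset.univ.filter (fun j : Fin N => (j : ℕ) < N - ⌈θ * N⌉₊) with hS
  have hcard : (Sᶜ.card : ℝ) ≤ θ * N + 1 := by
    have h1 : Sᶜ.card ≤ ⌈θ * N⌉₊ := by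
      have h2 : S.card = min N (N - ⌈θ * N⌉₊) := by
        rw [hS, Fin.card_filter_val_lt]
      rw [Finset.card_compl, Fintype.card_fin]
      omega
    calc (Sᶜ.card : ℝ) ≤ (⌈θ * N⌉₊ : ℝ) := by exact_mod_cast h1
      _ ≤ θ * N + 1 := (Nat.ceil_lt_add_one (by positivity)).le
  have hsum : ∑ i, w i ≤ ∑ j ∈ S, z (Tuple.sort z j) + (θ * N + 1) * B := by
    rw [← Equiv.sum_comp (Tuple.sort z) w, ← Finset.sum_add_sum_compl S]
    refine add_le_add (Finset.sum_le_sum fun j _ => hwz _) ?_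
    calc ∑ j ∈ Sᶜ, w (Tuple.sort z j) ≤ Sᶜ.card • B :=
          Finset.sum_le_card_nsmul _ _ _ fun j _ => hwB _
      _ ≤ (θ * N + 1) * B := by
          rw [nsmul_eq_mul]
          exact mul_le_mul_of_nonneg_right hcard hB
  have hN : (N : ℝ)⁻¹ * N ≤ 1 := inv_mul_le_one
  have h3 := mul_le_mul_of_nonneg_left hsum (show 0 ≤ (N : ℝ)⁻¹ by positivity)
  have h4 := mul_le_mul_of_nonneg_left hN (mul_nonneg hθ hB)
  unfold trimmedMean
  nlinarith

lemma sub_sqrt_le_of_dyadic {P q Δ : ℝ} (hΔ : 0 < Δ) (hP : Δ ≤ P)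
    (h : ∀ j : ℕ, Δ ≤ 2 ^ (-(j : ℝ)) * P → |q / P - 1| ≤ 2 ^ (-(j : ℝ) / 2)) :
    P - 2 * √Δ * √P ≤ q := by
  have hP0 : 0 < P := hΔ.trans_le hP
  obtain ⟨j, hj1, hj2⟩ := exists_nat_pow_near (x := P / Δ) ((one_le_div hΔ).2 hP)
    (one_lt_two : (1 : ℝ) < 2)
  have hpow : (2 : ℝ) ^ (-(j : ℝ)) = (2 ^ j)⁻¹ := by
    rw [Real.rpow_neg zero_le_two, Real.rpow_natCast]
  have h2j : (0 : ℝ) < 2 ^ j := by positivity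
  have hle : Δ ≤ 2 ^ (-(j : ℝ)) * P := by
    rw [hpow, inv_mul_eq_div, le_div_iff₀ h2j, mul_comm]
    exact (le_div_iff₀ hΔ).1 hj1
  have hq := (abs_le.1 (h j hle)).1
  have hsq : (2 : ℝ) ^ (-(j : ℝ) / 2) = √((2 ^ j)⁻¹) := by
    rw [← hpow, Real.sqrt_eq_rpow, ← Real.rpow_mul zero_le_two]
    ring_nf
  have hlt : (2 ^ j)⁻¹ * P ≤ 4 * Δ := by
    rw [inv_mul_eq_div, div_le_iff₀ h2j]
    have := (div_lt_iff₀ hΔ).1 hj2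
    rw [pow_succ] at this
    nlinarith
  have hroot : √((2 ^ j)⁻¹) * √P ≤ 2 * √Δ := by
    rw [← Real.sqrt_mul (by positivity)]
    refine (Real.sqrt_le_sqrt hlt).trans ?_
    rw [Real.sqrt_mul (by norm_num), show (4 : ℝ) = 2 ^ 2 by norm_num,
      Real.sqrt_sq zero_le_two]
  rw [hsq] at hq
  have h1 : P - √((2 ^ j)⁻¹) * P ≤ q := by
    have : (1 - √((2 ^ j)⁻¹)) * P ≤ q := (le_div_iff₀ hP0).1 (by linarith)
    linarith
  have h2 : √((2 ^ j)⁻¹) * P ≤ 2 * √Δ * √P := by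
    calc √((2 ^ j)⁻¹) * P = √((2 ^ j)⁻¹) * √P * √P := by
          rw [mul_assoc, Real.mul_self_sqrt hP0.le]
      _ ≤ 2 * √Δ * √P := mul_le_mul_of_nonneg_right hroot (Real.sqrt_nonneg _)
  linarith

section Quantile

variable {Ω : Type*} [MeasurableSpace Ω] {μ : Measure Ω} [IsProbabilityMeasure μ] {f : Ω → ℝ}
  {η : ℝ}

lemma nonneg_of_measure_lt (hf0 : ∀ ω, 0 ≤ f ω) (hη : η ≤ 1) {t : ℝ}
    (ht : (μ {ω | t < f ω}).toReal < η) : 0 ≤ t := by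
  by_contra! h
  have : {ω | t < f ω} = Set.univ := Set.eq_univ_of_forall fun ω => h.trans_le (hf0 ω)
  rw [this] at ht
  simp at ht
  linarith

lemma quant_nonneg (hf0 : ∀ ω, 0 ≤ f ω) (hη : η ≤ 1) : 0 ≤ quant μ f η :=
  Real.sInf_nonneg fun _ ht => nonneg_of_measure_lt hf0 hη ht

lemma le_measure_of_lt_quant (hf0 : ∀ ω, 0 ≤ f ω) (hη : η ≤ 1) {t : ℝ}
    (ht : t < quant μ f η) : η ≤ (μ {ω | t < f ω}).toReal := by
  by_contra! h
  exact absurd (csInf_le ⟨0, fun _ hs => nonneg_of_measure_lt hf0 hη hs⟩ h) (not_le.2 ht)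

lemma le_measure_quant (hf : Measurable f) (hf0 : ∀ ω, 0 ≤ f ω)
    (hatom : ∀ t : ℝ, μ {ω | f ω = t} = 0) (hη : η ≤ 1) :
    η ≤ (μ {ω | quant μ f η < f ω}).toReal := by
  set T := quant μ f η
  have h1 : μ {ω | T < f ω} = μ {ω | T ≤ f ω} := by
    refine le_antisymm (measure_mono fun ω (h : T < f ω) => h.le) ?_
    have : {ω | T ≤ f ω} ⊆ {ω | T < f ω} ∪ {ω | f ω = T} := by
      intro ω (h : T ≤ f ω)
      exact h.lt_or_eq.imp id Eq.symm
    calc μ {ω | T ≤ f ω} ≤ μ {ω | T < f ω} + μ {ω | f ω = T} :=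
          (measure_mono this).trans (measure_union_le _ _)
      _ = μ {ω | T < f ω} := by rw [hatom T, add_zero]
  rw [h1]
  obtain ⟨u, hu, huT, hlim⟩ := exists_seq_strictMono_tendsto T
  have hInter : {ω | T ≤ f ω} = ⋂ n, {ω | u n < f ω} := by
    ext ω
    simp only [Set.mem_ofPred_eq, Set.mem_iInter]
    exact ⟨fun h n => (huT n).trans_le h, fun h => le_of_tendsto' hlim fun n => (h n).le⟩
  have hanti : Antitone fun n => {ω | u n < f ω} :=
    fun m n hmn ω h => (hu.monotone hmn).trans_lt h
  have ht := tendsto_measure_iInter_atTop (μ := μ)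
    (fun n => (measurableSet_lt (measurable_const (a := u n)) hf).nullMeasurableSet) hanti
    ⟨0, measure_ne_top _ _⟩
  rw [hInter]
  exact ge_of_tendsto' ((ENNReal.tendsto_toReal (measure_ne_top _ _)).comp ht)
    fun n => le_measure_of_lt_quant hf0 hη (huT n)

end Quantile

theorem trimmed_mean_lower_bound :
    ∃ c₁ c₂ c₃ c₄ c₅ : ℝ, 0 < c₁ ∧ 0 < c₂ ∧ 0 < c₃ ∧ 0 < c₄ ∧ 0 < c₅ ∧
    ∀ (Ω : Type) (_ : MeasurableSpace Ω) (μ : Measure Ω), IsProbabilityMeasure μ →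
    ∀ (p : ℝ), 1 ≤ p →
    ∀ (f : Ω → ℝ), Measurable f → (∀ ω, 0 ≤ f ω) →
    Integrable (fun ω => f ω ^ p) μ →
    (∀ t : ℝ, μ {ω | f ω = t} = 0) →
    ∀ (N : ℕ) (Δ : ℝ), c₁ / N < Δ → Δ ≤ 1 / 2 →
    ∀ (x : Fin N → Ω), SatisfiesProps μ f x (1 / 2) 2 Δ →
    trimmedMean (fun i => f (x i) ^ p) (c₂ * Δ) ≥
      (∫ ω, f ω ^ p ∂μ) - c₄ * (errE μ f Δ p (quant μ f (c₃ * Δ)) +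
        ∫ ω in {ω | quant μ f (c₅ * Δ) < f ω}, f ω ^ p ∂μ) := by
  refine ⟨1, 1, 1, 3, 1, one_pos, one_pos, one_pos, three_pos, one_pos, ?_⟩
  intro Ω _ μ _ p hp f hf hf0 hfp hatom N Δ hNΔ hΔ x hx
  simp only [one_mul]
  have hN : (N : ℝ)⁻¹ ≤ Δ := by simpa using hNΔ.le
  have hΔ0 : 0 < Δ := lt_of_le_of_lt (by positivity) hNΔ
  have hp0 : 0 ≤ p := zero_le_one.trans hp
  set T := quant μ f Δ with hTdef
  have hT : 0 ≤ T := quant_nonneg hf0 (by linarith)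
  have hS : MeasurableSet {ω | T < f ω} := measurableSet_lt measurable_const hf
  have htrim : (N : ℝ)⁻¹ * ∑ i, min (f (x i)) T ^ p - (Δ + (N : ℝ)⁻¹) * T ^ p
      ≤ trimmedMean (fun i => f (x i) ^ p) Δ :=
    le_trimmedMean
      (fun i => Real.rpow_le_rpow (le_min (hf0 _) hT) (min_le_left _ _) hp0)
      (fun i => Real.rpow_le_rpow (le_min (hf0 _) hT) (min_le_right _ _) hp0)
      (Real.rpow_nonneg hT p) hΔ0.le
  rw [sum_min_rpow_eq hf0 hp hT x] at htrim
  have hsqrt : Antitone fun t => √((μ {ω | t < f ω}).toReal) :=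
    fun s t hst => Real.sqrt_le_sqrt (antitone_measureReal_lt μ f hst)
  have hiP := intervalIntegrable_rpow_mul (T := T) hp (antitone_measureReal_lt μ f)
  have hiS := intervalIntegrable_rpow_mul (T := T) hp hsqrt
  have hcomp : (∫ ω, min (f ω) T ^ p ∂μ) - errE μ f Δ p T
      ≤ ∫ t in (0 : ℝ)..T, p * t ^ (p - 1) * empP x {ω | t < f ω} := by
    rw [integral_min_rpow_eq μ hf hf0 hp hT, errE, ← intervalIntegral.integral_const_mul,
      ← intervalIntegral.integral_sub hiP (hiS.const_mul _)]
    refine intervalIntegral.integral_mono_on_of_le_Ioo hT (hiP.sub (hiS.const_mul _))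
      (intervalIntegrable_rpow_mul hp (antitone_empP_lt f x)) fun t ht => ?_
    have := sub_sqrt_le_of_dyadic hΔ0 (le_measure_of_lt_quant hf0 (by linarith) ht.2)
      fun j hj => hx.2.1 j t ht.1 hj
    have h2 := mul_le_mul_of_nonneg_left this
      (mul_nonneg hp0 (Real.rpow_nonneg ht.1.le (p - 1)))
    linarith
  have herr : 0 ≤ errE μ f Δ p T := by
    refine mul_nonneg (by positivity) (intervalIntegral.integral_nonneg hT fun t ht => ?_)
    exact mul_nonneg (mul_nonneg hp0 (Real.rpow_nonneg ht.1 _)) (Real.sqrt_nonneg _)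
  have htail : Δ * T ^ p ≤ ∫ ω in {ω | T < f ω}, f ω ^ p ∂μ := by
    calc Δ * T ^ p ≤ (μ {ω | T < f ω}).toReal * T ^ p :=
          mul_le_mul_of_nonneg_right (le_measure_quant hf hf0 hatom (by linarith))
            (Real.rpow_nonneg hT p)
      _ = ∫ _ in {ω | T < f ω}, T ^ p ∂μ := by simp [Measure.real]
      _ ≤ _ := setIntegral_mono_on (integrable_const _) hfp.integrableOn hS
          fun ω (h : T < f ω) => Real.rpow_le_rpow hT h.le hp0
  have hmain : (∫ ω, f ω ^ p ∂μ) - ∫ ω in {ω | T < f ω}, f ω ^ p ∂μ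
      ≤ ∫ ω, min (f ω) T ^ p ∂μ := by
    rw [← integral_indicator hS, ← integral_sub hfp (hfp.indicator hS)]
    have hmin : Integrable (fun ω => min (f ω) T ^ p) μ := by
      refine hfp.mono' ((hf.min measurable_const).pow_const p).aestronglyMeasurable
        (Filter.Eventually.of_forall fun ω => ?_)
      rw [Real.norm_of_nonneg (Real.rpow_nonneg (le_min (hf0 _) hT) _)]
      exact Real.rpow_le_rpow (le_min (hf0 _) hT) (min_le_left _ _) hp0
    refine integral_mono (hfp.sub (hfp.indicator hS)) hmin fun ω => ?_
    by_cases h : T < f ω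
    · simpa [h] using Real.rpow_nonneg (le_min (hf0 ω) hT) p
    · simp [h, min_eq_left (not_lt.1 h)]
  have hNT : (N : ℝ)⁻¹ * T ^ p ≤ Δ * T ^ p :=
    mul_le_mul_of_nonneg_right hN (Real.rpow_nonneg hT p)
  linarith
end

section
/- There exist absolute constants c₁, c₂, c > 0 such that the following holds. Let p ≥ 1, q > 2p, and let f be a nonnegative measurable function of a random variable X such that E f(X)^q < ∞ and the distribution of f(X) is atomless. Let N ∈ ℕ, let c₁/N ≤ Δ ≤ 1/2, set θ = c₂Δ, and let x_1,…,x_N be points such that the sample satisfies Properties (1)–(3) for f with constants λ = 1/2, C = 2 and Δ. Then | (1/N)·Σ_{j ≥ θN} (f(x_i)^p)_j^* − E f(X)^p | ≤ c·(1 + p/(q−2p))·√Δ·‖f(X)‖_{L_q}^p, where the trimmed mean on the left is the sum of the values f(x_i)^p after discarding the ⌈θN⌉ largest ones, divided by N. -/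
open MeasureTheory Real

/-- The number of sample values exceeding `s` that survive after discarding the `k` largest. -/
noncomputable def trimmedCount {N : ℕ} (z : Fin N → ℝ) (k : ℕ) (s : ℝ) : ℕ :=
  (Finset.univ.filter
    (fun j : Fin N => (j : ℕ) < N - k ∧ s < z (Tuple.sort z j))).card

lemma card_lt_comp_sort {N : ℕ} (z : Fin N → ℝ) (s : ℝ) :
    (Finset.univ.filter (fun j : Fin N => s < z (Tuple.sort z j))).card =
      (Finset.univ.filter (fun i : Fin N => s < z i)).card := by
  refine Finset.card_bij (fun j _ => Tuple.sort z j) ?_ ?_ ?_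
  · intro j hj
    simpa using hj
  · intro a _ b _ h
    exact (Tuple.sort z).injective h
  · intro i hi
    exact ⟨(Tuple.sort z).symm i, by simpa using hi, by simp⟩

lemma trimmedCount_le {N : ℕ} (z : Fin N → ℝ) (k : ℕ) (s : ℝ) :
    trimmedCount z k s ≤ (Finset.univ.filter (fun i : Fin N => s < z i)).card := by
  rw [← card_lt_comp_sort, trimmedCount]
  refine Finset.card_le_card fun j hj => ?_
  simp only [Finset.mem_filter, Finset.mem_univ, true_and] at hj ⊢
  exact hj.2

lemma le_trimmedCount_add {N : ℕ} (z : Fin N → ℝ) (k : ℕ) (s : ℝ) :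
    (Finset.univ.filter (fun i : Fin N => s < z i)).card ≤ trimmedCount z k s + k := by
  have hk : (Finset.univ.filter (fun j : Fin N => ¬ (j : ℕ) < N - k)).card ≤ k := by
    have h := Finset.card_filter_add_card_filter_not (s := (Finset.univ : Finset (Fin N)))
      (fun j : Fin N => (j : ℕ) < N - k)
    rw [Fin.card_filter_val_lt, Finset.card_univ, Fintype.card_fin] at h
    omega
  rw [← card_lt_comp_sort, trimmedCount]
  refine le_trans ?_ (Nat.add_le_add_left hk _)
  refine le_trans (Finset.card_le_card fun j hj => ?_) (Finset.card_union_le _ _)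
  simp only [Finset.mem_filter, Finset.mem_univ, true_and, Finset.mem_union] at hj ⊢
  tauto

lemma trimmedCount_eq_zero {N : ℕ} (z : Fin N → ℝ) (k : ℕ) (s : ℝ)
    (h : (Finset.univ.filter (fun i : Fin N => s < z i)).card ≤ k) :
    trimmedCount z k s = 0 := by
  rw [trimmedCount, Finset.card_eq_zero, Finset.filter_eq_empty_iff]
  rintro j - ⟨hj, hs⟩
  have hsub : Finset.Ici j ⊆ Finset.univ.filter (fun j : Fin N => s < z (Tuple.sort z j)) := by
    intro i hi
    simp only [Finset.mem_filter, Finset.mem_univ, true_and]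
    exact hs.trans_le (Tuple.monotone_sort z (Finset.mem_Ici.mp hi))
  have hcard := Finset.card_le_card hsub
  rw [card_lt_comp_sort, Fin.card_Ici] at hcard
  omega

lemma trimmedCount_eq_sum {N : ℕ} (z : Fin N → ℝ) (k : ℕ) (s : ℝ) :
    (trimmedCount z k s : ℝ) =
      ∑ j ∈ Finset.univ.filter (fun j : Fin N => (j : ℕ) < N - k),
        (Set.Iio (z (Tuple.sort z j))).indicator (fun _ => (1 : ℝ)) s := by
  simp only [Set.indicator_apply, Set.mem_Iio]
  rw [Finset.sum_boole, Finset.filter_filter, trimmedCount]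

lemma integrableOn_indicator_Iio (a : ℝ) :
    IntegrableOn ((Set.Iio a).indicator (fun _ => (1 : ℝ))) (Set.Ioi 0) := by
  rw [IntegrableOn, integrable_indicator_iff measurableSet_Iio, IntegrableOn,
    Measure.restrict_restrict measurableSet_Iio]
  have : Set.Iio a ∩ Set.Ioi 0 = Set.Ioo 0 a := by ext; simp [and_comm]
  rw [this]
  exact integrable_const _

lemma setIntegral_indicator_Iio {a : ℝ} (ha : 0 ≤ a) :
    ∫ s in Set.Ioi 0, (Set.Iio a).indicator (fun _ => (1 : ℝ)) s = a := by
  have : Set.Ioi 0 ∩ Set.Iio a = Set.Ioo 0 a := rfl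
  rw [setIntegral_indicator measurableSet_Iio, this]
  simp [ha]

lemma integrableOn_trimmedCount {N : ℕ} (z : Fin N → ℝ) (k : ℕ) :
    IntegrableOn (fun s => (N : ℝ)⁻¹ * (trimmedCount z k s : ℝ)) (Set.Ioi 0) := by
  simp only [trimmedCount_eq_sum]
  exact (integrable_finsetSum _ fun j _ => integrableOn_indicator_Iio _).const_mul _

lemma trimmedMean_eq_integral {N : ℕ} (z : Fin N → ℝ) (hz : ∀ i, 0 ≤ z i) (θ : ℝ) :
    trimmedMean z θ =
      ∫ s in Set.Ioi 0, (N : ℝ)⁻¹ * (trimmedCount z (Nat.ceil (θ * N)) s : ℝ) := by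
  simp only [trimmedCount_eq_sum]
  rw [integral_const_mul, integral_finsetSum _ fun j _ => integrableOn_indicator_Iio _,
    trimmedMean]
  simp only [setIntegral_indicator_Iio (hz _)]

lemma empP_eq_card {Ω : Type*} {N : ℕ} (x : Fin N → Ω) (g : Ω → ℝ) (s : ℝ) :
    empP x {ω | s < g ω} =
      (N : ℝ)⁻¹ * ((Finset.univ.filter (fun i : Fin N => s < g (x i))).card : ℝ) := by
  rw [empP]
  simp only [Set.indicator_apply, Set.mem_ofPred_eq]
  rw [Finset.sum_boole]

/-- Property (2) gives a deviation of order `√(Δ P)` for the tail probabilities `P ≥ Δ`. -/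
lemma abs_sub_le_of_dyadic {P PN Δ : ℝ} (hΔ : 0 < Δ) (hP : Δ ≤ P)
    (h : ∀ j : ℕ, Δ ≤ 2 ^ (-(j : ℝ)) * P → |PN / P - 1| ≤ 2 ^ (-(j : ℝ) / 2)) :
    |PN - P| ≤ 2 * √(Δ * P) := by
  have hP0 : 0 < P := hΔ.trans_le hP
  obtain ⟨n, hn, hn'⟩ := exists_nat_pow_near ((one_le_div hΔ).mpr hP) (one_lt_two)
  have hpow : (2 : ℝ) ^ (-(n : ℝ)) = ((2 : ℝ) ^ n)⁻¹ := by
    rw [rpow_neg zero_le_two, rpow_natCast]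
  have h2n : (0 : ℝ) < 2 ^ n := by positivity
  have hj := h n (by
    rw [hpow, inv_mul_eq_div, le_div_iff₀ h2n, mul_comm]
    exact (le_div_iff₀ hΔ).mp hn)
  have hsq : ((2 : ℝ) ^ (-(n : ℝ) / 2)) ^ 2 = ((2 : ℝ) ^ n)⁻¹ := by
    rw [← hpow, ← rpow_natCast, ← rpow_mul zero_le_two]
    congr 1
    push_cast
    ring
  have hlt : ((2 : ℝ) ^ n)⁻¹ * P ≤ 2 * Δ := by
    rw [inv_mul_eq_div, div_le_iff₀ h2n]
    have := (div_lt_iff₀ hΔ).mp hn'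
    rw [pow_succ] at this
    linarith
  have heq : PN - P = P * (PN / P - 1) := by field_simp
  rw [heq, abs_mul, abs_of_pos hP0]
  refine (mul_le_mul_of_nonneg_left hj hP0.le).trans ?_
  refine abs_le_of_sq_le_sq' ?_ (by positivity) |>.2
  rw [mul_pow, hsq, mul_pow, sq_sqrt (by positivity)]
  nlinarith [mul_le_mul_of_nonneg_left hlt hP0.le, mul_pos hΔ hP0]

lemma le_sqrt_mul_of_le {a b : ℝ} (ha : 0 ≤ a) (h : a ≤ b) : a ≤ √(a * b) :=
  le_sqrt_of_sq_le (by nlinarith)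

lemma abs_trimmedCount_sub_le {Ω : Type*} [MeasurableSpace Ω] {μ : Measure Ω}
    {f : Ω → ℝ} (hf : ∀ ω, 0 ≤ f ω) {p : ℝ} (hp : 0 < p) {N : ℕ} {Δ : ℝ} (hΔ : 1 / N ≤ Δ)
    {x : Fin N → Ω} (hx : SatisfiesProps μ f x (1 / 2) 2 Δ) {s : ℝ} (hs : 0 < s) :
    |(N : ℝ)⁻¹ * (trimmedCount (fun i => f (x i) ^ p) (Nat.ceil (4 * Δ * N)) s : ℝ) -
        μ.real {ω | s < f ω ^ p}| ≤ 7 * √(Δ * μ.real {ω | s < f ω ^ p}) := by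
  obtain ⟨h1, h2, h3⟩ := hx
  have hset : {ω | s < f ω ^ p} = {ω | s ^ p⁻¹ < f ω} := by
    ext ω
    exact (rpow_inv_lt_iff_of_pos hs.le (hf ω) hp).symm
  have hPN := empP_eq_card x (fun ω => f ω ^ p) s
  have ht : 0 < s ^ p⁻¹ := rpow_pos_of_pos hs _
  specialize h1 _ ht
  have h2 := fun j => h2 j _ ht
  have h3 := h3 (Set.Ioi (s ^ p⁻¹)) Set.ordConnected_Ioi
  simp only [Set.mem_Ioi] at h3
  rw [← hset] at h1 h2 h3
  change Δ ≤ μ.real _ → |_ / μ.real _ - 1| ≤ _ at h1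
  change ∀ j : ℕ, Δ ≤ _ * μ.real _ → |_ / μ.real _ - 1| ≤ _ at h2
  change _ ≤ _ * μ.real _ + _ at h3
  have hP0 : 0 ≤ μ.real {ω | s < f ω ^ p} := measureReal_nonneg
  set P := μ.real {ω | s < f ω ^ p}
  have hΔ0 : 0 ≤ Δ := le_trans (by positivity) hΔ
  have hle := trimmedCount_le (fun i => f (x i) ^ p) (Nat.ceil (4 * Δ * N)) s
  have hge := le_trimmedCount_add (fun i => f (x i) ^ p) (Nat.ceil (4 * Δ * N)) s
  have hzero := trimmedCount_eq_zero (fun i => f (x i) ^ p) (Nat.ceil (4 * Δ * N)) s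
  set c := trimmedCount (fun i => f (x i) ^ p) (Nat.ceil (4 * Δ * N)) s
  set a := (Finset.univ.filter (fun i : Fin N => s < f (x i) ^ p)).card
  rcases Nat.eq_zero_or_pos N with rfl | hN
  · have hlt : P < Δ := by
      by_contra! hcon
      have := h1 hcon
      rw [hPN] at this
      norm_num at this
    have := le_sqrt_mul_of_le hP0 hlt.le
    rw [mul_comm] at this
    simp only [Nat.cast_zero, inv_zero, zero_mul, zero_sub, abs_neg, abs_of_nonneg hP0]
    linarith [sqrt_nonneg (Δ * P)]
  have hNR : (0 : ℝ) < N := by exact_mod_cast hN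
  have hΔpos : 0 < Δ := lt_of_lt_of_le (by positivity) hΔ
  rcases lt_or_ge P Δ with hlt | hge'
  · have hc : c = 0 := by
      apply hzero
      rw [hPN, inv_mul_eq_div, div_le_iff₀ hNR] at h3
      have : (a : ℝ) ≤ 4 * Δ * N := h3.trans (by gcongr; linarith)
      exact_mod_cast this.trans (Nat.le_ceil _)
    have := le_sqrt_mul_of_le hP0 hlt.le
    rw [mul_comm] at this
    simp only [hc, Nat.cast_zero, mul_zero, zero_sub, abs_neg, abs_of_nonneg hP0]
    linarith [sqrt_nonneg (Δ * P)]
  · have hdev := abs_sub_le_of_dyadic hΔpos hge' h2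
    have hsqrt := le_sqrt_mul_of_le hΔ0 hge'
    rw [hPN] at hdev
    have hk : (N : ℝ)⁻¹ * (Nat.ceil (4 * Δ * N) : ℝ) ≤ 5 * Δ := by
      have := (Nat.ceil_lt_add_one (by positivity : 0 ≤ 4 * Δ * N)).le
      rw [inv_mul_eq_div, div_le_iff₀ hNR]
      have := (div_le_iff₀ hNR).mp hΔ
      linarith
    have hle' : (N : ℝ)⁻¹ * (c : ℝ) ≤ (N : ℝ)⁻¹ * (a : ℝ) := by gcongr
    have hge'' : (N : ℝ)⁻¹ * (a : ℝ) ≤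
        (N : ℝ)⁻¹ * (c : ℝ) + (N : ℝ)⁻¹ * (Nat.ceil (4 * Δ * N) : ℝ) := by
      rw [← mul_add]
      gcongr
      exact_mod_cast hge
    rw [abs_le] at hdev ⊢
    constructor <;> linarith [hdev.1, hdev.2]

/-- The square root of the Markov bound `min(1, M s^{-r})` on the tail. -/
noncomputable def sqrtTailBound (M r s : ℝ) : ℝ :=
  if s ≤ M ^ r⁻¹ then 1 else √M * s ^ (-(r / 2))

lemma sqrt_le_sqrtTailBound {M r s P : ℝ} (hs : 0 < s) (hP : P ≤ 1)
    (h : s ^ r * P ≤ M) : √P ≤ sqrtTailBound M r s := by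
  rw [sqrtTailBound]
  split_ifs
  · exact sqrt_le_one.mpr hP
  · have hsr : 0 < s ^ r := rpow_pos_of_pos hs r
    have hexp : s ^ (-(r / 2)) = √(s ^ r)⁻¹ := by
      rw [sqrt_eq_rpow, ← rpow_neg hs.le, ← rpow_mul hs.le]
      ring_nf
    rw [hexp, ← sqrt_mul' _ (by positivity)]
    refine sqrt_le_sqrt ?_
    rw [← div_eq_mul_inv, le_div_iff₀ hsr, mul_comm]
    exact h

lemma sqrtTailBound_integral {M r : ℝ} (hM : 0 < M) (hr : 2 < r) :
    IntegrableOn (sqrtTailBound M r) (Set.Ioi 0) ∧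
      ∫ s in Set.Ioi 0, sqrtTailBound M r s = (1 + 2 / (r - 2)) * M ^ r⁻¹ := by
  have hA : 0 < M ^ r⁻¹ := rpow_pos_of_pos hM _
  have hsplit : Set.Ioc 0 (M ^ r⁻¹) ∪ Set.Ioi (M ^ r⁻¹) = Set.Ioi 0 :=
    Set.Ioc_union_Ioi_eq_Ioi hA.le
  have heq1 : Set.EqOn (fun _ => (1 : ℝ)) (sqrtTailBound M r) (Set.Ioc 0 (M ^ r⁻¹)) :=
    fun s hs => by simp [sqrtTailBound, hs.2]
  have heq2 : Set.EqOn (fun s => √M * s ^ (-(r / 2))) (sqrtTailBound M r)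
      (Set.Ioi (M ^ r⁻¹)) :=
    fun s hs => by simp [sqrtTailBound, not_le.mpr (Set.mem_Ioi.mp hs)]
  have hi1 : IntegrableOn (sqrtTailBound M r) (Set.Ioc 0 (M ^ r⁻¹)) :=
    IntegrableOn.congr_fun (integrableOn_const (by simp)) heq1 measurableSet_Ioc
  have hi2 : IntegrableOn (sqrtTailBound M r) (Set.Ioi (M ^ r⁻¹)) :=
    IntegrableOn.congr_fun
      ((integrableOn_Ioi_rpow_of_lt (by linarith : -(r / 2) < -1) hA).const_mul _)
      heq2 measurableSet_Ioi
  refine ⟨hsplit ▸ hi1.union hi2, ?_⟩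
  rw [← hsplit, setIntegral_union (Set.Ioc_disjoint_Ioi le_rfl) measurableSet_Ioi hi1 hi2,
    ← setIntegral_congr_fun measurableSet_Ioc heq1,
    ← setIntegral_congr_fun measurableSet_Ioi heq2, integral_const_mul,
    integral_Ioi_rpow_of_lt (by linarith : -(r / 2) < -1) hA]
  have hpow : √M * (M ^ r⁻¹) ^ (-(r / 2) + 1) = M ^ r⁻¹ := by
    rw [sqrt_eq_rpow, ← rpow_mul hM.le, ← rpow_add hM]
    congr 1
    field_simp
    ring
  have h1 : (-(r / 2) + 1) ≠ 0 := by linarith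
  have h2 : r - 2 ≠ 0 := by linarith
  have hfac : √M * (-(M ^ r⁻¹) ^ (-(r / 2) + 1) / (-(r / 2) + 1)) =
      2 / (r - 2) * (√M * (M ^ r⁻¹) ^ (-(r / 2) + 1)) := by
    rw [show -(r / 2) + 1 = -((r - 2) / 2) by ring, neg_div_neg_eq]
    field_simp
  rw [hfac, hpow]
  simp [hA.le]
  ring

lemma rpow_mul_measureReal_lt_le {Ω : Type*} [MeasurableSpace Ω] {μ : Measure Ω}
    [IsFiniteMeasure μ] {f : Ω → ℝ} (hf : ∀ ω, 0 ≤ f ω) {p q : ℝ} (hp : 0 < p) (hq : 0 < q)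
    (hint : Integrable (fun ω => f ω ^ q) μ) {s : ℝ} (hs : 0 < s) :
    s ^ (q / p) * μ.real {ω | s < f ω ^ p} ≤ ∫ ω, f ω ^ q ∂μ := by
  refine le_trans ?_ (mul_meas_ge_le_integral_of_nonneg
    (Filter.Eventually.of_forall fun ω => rpow_nonneg (hf ω) q) hint (s ^ (q / p)))
  refine mul_le_mul_of_nonneg_left (measureReal_mono fun ω hω => ?_) (by positivity)
  have h : s ^ (q / p) ≤ (f ω ^ p) ^ (q / p) :=
    rpow_le_rpow hs.le (le_of_lt hω) (by positivity)
  rwa [← rpow_mul (hf ω), mul_div_cancel₀ _ hp.ne'] at h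

lemma integrable_rpow_of_le {Ω : Type*} [MeasurableSpace Ω] {μ : Measure Ω}
    [IsFiniteMeasure μ] {f : Ω → ℝ} (hfm : Measurable f) (hf : ∀ ω, 0 ≤ f ω) {p q : ℝ}
    (hp : 0 ≤ p) (hpq : p ≤ q) (hint : Integrable (fun ω => f ω ^ q) μ) :
    Integrable (fun ω => f ω ^ p) μ := by
  refine Integrable.mono' ((integrable_const (1 : ℝ)).add hint) (hfm.pow_const p).aestronglyMeasurable
    (Filter.Eventually.of_forall fun ω => ?_)
  rw [norm_eq_abs, abs_of_nonneg (rpow_nonneg (hf ω) p), Pi.add_apply]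
  have hq := rpow_nonneg (hf ω) q
  rcases le_total (f ω) 1 with h | h
  · linarith [rpow_le_one (hf ω) h hp]
  · linarith [rpow_le_rpow_of_exponent_le h hpq]

lemma integral_rpow_pos_of_atomless {Ω : Type*} [MeasurableSpace Ω] {μ : Measure Ω}
    [IsProbabilityMeasure μ] {f : Ω → ℝ} (hf : ∀ ω, 0 ≤ f ω) {q : ℝ}
    (hint : Integrable (fun ω => f ω ^ q) μ) (h0 : μ {ω | f ω = 0} = 0) :
    0 < ∫ ω, f ω ^ q ∂μ := by
  rw [integral_pos_iff_support_of_nonneg (fun ω => rpow_nonneg (hf ω) q) hint]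
  have hae : ∀ᵐ ω ∂μ, f ω ≠ 0 := by
    rw [ae_iff]
    simpa using h0
  have hsupp : ∀ᵐ ω ∂μ, ω ∈ Function.support (fun ω => f ω ^ q) := by
    filter_upwards [hae] with ω hω
    exact (rpow_pos_of_pos (lt_of_le_of_ne (hf ω) hω.symm) q).ne'
  rw [measure_eq_measure_of_null_sdiff (Set.subset_univ _)
    (by rw [← Set.compl_eq_univ_sdiff]; exact hsupp)]
  simp

theorem trimmed_mean_two_sided_Lq :
    ∃ c₁ c₂ c : ℝ, 0 < c₁ ∧ 0 < c₂ ∧ 0 < c ∧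
    ∀ (Ω : Type) (_ : MeasurableSpace Ω) (μ : Measure Ω), IsProbabilityMeasure μ →
    ∀ (p q : ℝ), 1 ≤ p → 2 * p < q →
    ∀ (f : Ω → ℝ), Measurable f → (∀ ω, 0 ≤ f ω) →
    Integrable (fun ω => f ω ^ q) μ →
    (∀ t : ℝ, μ {ω | f ω = t} = 0) →
    ∀ (N : ℕ) (Δ : ℝ), c₁ / N ≤ Δ → Δ ≤ 1 / 2 →
    ∀ (x : Fin N → Ω), SatisfiesProps μ f x (1 / 2) 2 Δ →
    |trimmedMean (fun i => f (x i) ^ p) (c₂ * Δ) - ∫ ω, f ω ^ p ∂μ| ≤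
      c * (1 + p / (q - 2 * p)) * Real.sqrt Δ * (∫ ω, f ω ^ q ∂μ) ^ (p / q) := by
  refine ⟨1, 4, 14, by norm_num, by norm_num, by norm_num, ?_⟩
  intro Ω _ μ _ p q hp hpq f hfm hf hint hatom N Δ hΔ _ x hx
  have hp0 : 0 < p := by linarith
  have hq0 : 0 < q := by linarith
  have hΔ0 : 0 ≤ Δ := le_trans (by positivity) hΔ
  have hM := integral_rpow_pos_of_atomless hf hint (hatom 0)
  have hr : 2 < q / p := by rwa [lt_div_iff₀ hp0]
  obtain ⟨hgint, hgval⟩ := sqrtTailBound_integral hM hr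
  have hsqrt : ∀ s ∈ Set.Ioi (0 : ℝ), √(μ.real {ω | s < f ω ^ p}) ≤
      sqrtTailBound (∫ ω, f ω ^ q ∂μ) (q / p) s := fun s hs =>
    sqrt_le_sqrtTailBound hs measureReal_le_one (rpow_mul_measureReal_lt_le hf hp0 hq0 hint hs)
  have hanti : Antitone fun s : ℝ => μ.real {ω | s < f ω ^ p} := fun s t hst =>
    measureReal_mono fun ω hω => lt_of_le_of_lt hst hω
  have hPint : IntegrableOn (fun s : ℝ => μ.real {ω | s < f ω ^ p}) (Set.Ioi 0) := by
    refine Integrable.mono' hgint hanti.measurable.aestronglyMeasurable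
      (ae_restrict_of_forall_mem measurableSet_Ioi fun s hs => ?_)
    rw [norm_eq_abs, abs_of_nonneg measureReal_nonneg]
    refine le_trans (le_sqrt_of_sq_le ?_) (hsqrt s hs)
    exact pow_le_of_le_one measureReal_nonneg measureReal_le_one two_ne_zero
  have hlayer := (integrable_rpow_of_le hfm hf hp0.le (by linarith) hint).integral_eq_integral_meas_lt
    (Filter.Eventually.of_forall fun ω => rpow_nonneg (hf ω) p)
  rw [trimmedMean_eq_integral _ (fun i => rpow_nonneg (hf (x i)) p), hlayer,
    ← integral_sub (integrableOn_trimmedCount _ _) hPint, ← norm_eq_abs]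
  refine (norm_integral_le_of_norm_le (hgint.const_mul (7 * √Δ))
    (ae_restrict_of_forall_mem measurableSet_Ioi fun s hs => ?_)).trans ?_
  · rw [norm_eq_abs]
    refine (abs_trimmedCount_sub_le hf hp0 hΔ hx hs).trans ?_
    rw [sqrt_mul hΔ0, ← mul_assoc]
    exact mul_le_mul_of_nonneg_left (hsqrt s hs) (by positivity)
  · rw [integral_const_mul, hgval, inv_div]
    have hpos : 0 < q - 2 * p := by linarith
    have hconst : 2 / (q / p - 2) = 2 * (p / (q - 2 * p)) := by
      have : q / p - 2 = (q - 2 * p) / p := by field_simp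
      rw [this, div_div_eq_mul_div, mul_div_assoc]
    rw [hconst]
    have hnn : 0 ≤ 7 * √Δ * (∫ ω, f ω ^ q ∂μ) ^ (p / q) := by positivity
    linarith
end

section
/- Let p ≥ 1, let f be a nonnegative measurable function of a random variable X with E f(X)^p < ∞, let 0 < Δ ≤ 1/2, and let T > 0 satisfy P(f > T) ≥ Δ. Suppose the points x_1,…,x_N satisfy: for every 0 < t < T and every natural number j, if 2^{−j}·P(f > t) ≥ Δ then |P_N(f > t)/P(f > t) − 1| ≤ 2^{−j/2}. Then ∫_0^T p·t^{p−1}·P_N(f > t) dt ≥ E[f(X)^p · 1_{f(X) ≤ T}] − E_{T,p}(f). -/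
open MeasureTheory Real

theorem empP_mono {Ω : Type*} {N : ℕ} (x : Fin N → Ω) {s t : Set Ω} (h : s ⊆ t) :
    empP x s ≤ empP x t := by
  unfold empP
  gcongr

theorem measureReal_tail_antitone {Ω : Type*} [MeasurableSpace Ω] (μ : Measure Ω)
    [IsFiniteMeasure μ] (f : Ω → ℝ) : Antitone fun t : ℝ => (μ {ω | t < f ω}).toReal :=
  fun _ _ hst => ENNReal.toReal_mono (measure_ne_top _ _)
    (measure_mono fun _ hω => lt_of_le_of_lt hst hω)

/-- A relative deviation bound at every dyadic scale above `Δ` gives the lower bound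
`P - 2 √Δ √P`. -/
theorem sub_two_mul_sqrt_le_of_dyadic {P Q Δ : ℝ} (hΔ : 0 < Δ) (hP : Δ ≤ P)
    (h : ∀ j : ℕ, Δ ≤ 2 ^ (-(j : ℝ)) * P → |Q / P - 1| ≤ 2 ^ (-(j : ℝ) / 2)) :
    P - 2 * √Δ * √P ≤ Q := by
  have hP0 : 0 < P := hΔ.trans_le hP
  obtain ⟨j, hj1, hj2⟩ := exists_nat_pow_near ((one_le_div hΔ).2 hP) (one_lt_two (α := ℝ))
  have hpow : (0 : ℝ) < 2 ^ j := by positivity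
  rw [le_div_iff₀ hΔ] at hj1
  rw [div_lt_iff₀ hΔ, pow_succ] at hj2
  have hneg : (2 : ℝ) ^ (-(j : ℝ)) = (2 ^ j)⁻¹ := by
    rw [rpow_neg zero_le_two, rpow_natCast]
  have hdev := h j (by rw [hneg, inv_mul_eq_div, le_div_iff₀ hpow]; linarith)
  set r : ℝ := 2 ^ (-(j : ℝ) / 2) with hr
  have hr0 : 0 < r := by positivity
  have hrsq : r ^ 2 = (2 ^ j)⁻¹ := by
    rw [← hneg, hr, ← rpow_natCast, ← rpow_mul zero_le_two]
    norm_num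
  have hrP : r ^ 2 * P ≤ 2 * Δ := by
    rw [hrsq, inv_mul_eq_div, div_le_iff₀ hpow]; linarith
  have hsP : √P ^ 2 = P := sq_sqrt hP0.le
  have hsΔ : √Δ ^ 2 = Δ := sq_sqrt hΔ.le
  have hrs : r * √P ≤ 2 * √Δ := by
    refine abs_le_of_sq_le_sq' ?_ (by positivity) |>.2
    rw [mul_pow, mul_pow, hsP, hsΔ]; linarith
  have hlow : (1 - r) * P ≤ Q := by
    rw [← le_div_iff₀ hP0]
    linarith [(abs_le.1 hdev).1]
  nlinarith [mul_le_mul_of_nonneg_right hrs (sqrt_nonneg P)]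

/-- Layer-cake bound for a truncated moment. -/
theorem setIntegral_rpow_le_intervalIntegral_tail {Ω : Type*} [MeasurableSpace Ω]
    (μ : Measure Ω) [IsFiniteMeasure μ] {p : ℝ} (hp : 1 ≤ p) {f : Ω → ℝ} (hf : Measurable f)
    (hf0 : ∀ ω, 0 ≤ f ω) {T : ℝ} (hT : 0 ≤ T) :
    ∫ ω in {ω | f ω ≤ T}, f ω ^ p ∂μ ≤
      ∫ t in (0 : ℝ)..T, p * t ^ (p - 1) * (μ {ω | t < f ω}).toReal := by
  have hp0 : 0 < p := by linarith
  have hs : MeasurableSet {ω | f ω ≤ T} := measurableSet_le hf measurable_const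
  have hint : IntervalIntegrable
      (fun t : ℝ => p * t ^ (p - 1) * (μ {ω | t < f ω}).toReal) volume 0 T :=
    (measureReal_tail_antitone μ f).intervalIntegrable.continuousOn_mul
      (continuous_const.mul (continuous_rpow_const (by linarith))).continuousOn
  have hnn : ∀ t ∈ Set.Ioc 0 T, 0 ≤ p * t ^ (p - 1) * (μ {ω | t < f ω}).toReal := fun t ht =>
    mul_nonneg (mul_nonneg hp0.le (rpow_nonneg ht.1.le _)) ENNReal.toReal_nonneg
  rw [intervalIntegral.integral_of_le hT,
    integral_eq_lintegral_of_nonneg_ae (.of_forall fun ω => rpow_nonneg (hf0 ω) p)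
      (hf.pow_const p).aestronglyMeasurable]
  refine ENNReal.toReal_le_of_le_ofReal (setIntegral_nonneg measurableSet_Ioc hnn) ?_
  rw [ofReal_integral_eq_lintegral_ofReal hint.1
      (ae_restrict_of_forall_mem measurableSet_Ioc hnn),
    lintegral_rpow_eq_lintegral_meas_lt_mul _ (.of_forall hf0) hf.aemeasurable hp0,
    ← lintegral_const_mul' _ _ ENNReal.ofReal_ne_top,
    ← lintegral_indicator measurableSet_Ioi, ← lintegral_indicator measurableSet_Ioc]
  refine lintegral_mono fun t => ?_
  by_cases ht0 : 0 < t
  swap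
  · simp [ht0]
  rw [Set.indicator_of_mem (Set.mem_Ioi.2 ht0), Measure.restrict_apply' hs]
  by_cases htT : t ≤ T
  · rw [Set.indicator_of_mem (Set.mem_Ioc.2 ⟨ht0, htT⟩),
      ENNReal.ofReal_mul (mul_nonneg hp0.le (rpow_nonneg ht0.le _)), ENNReal.ofReal_mul hp0.le,
      ENNReal.ofReal_toReal (measure_ne_top _ _), mul_comm (μ _), mul_assoc]
    gcongr
    exact Set.inter_subset_left
  · have : {ω | t < f ω} ∩ {ω | f ω ≤ T} = ∅ := by
      ext ω
      simp only [Set.mem_inter_iff, Set.mem_ofPred_eq, Set.mem_empty_iff_false, iff_false]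
      rintro ⟨h1, h2⟩
      exact htT (h1.le.trans h2)
    simp [this]

theorem empirical_tail_integral_lower
    (Ω : Type) [MeasurableSpace Ω] (μ : Measure Ω) [IsProbabilityMeasure μ]
    (p : ℝ) (hp : 1 ≤ p)
    (f : Ω → ℝ) (hmeas : Measurable f) (hnonneg : ∀ ω, 0 ≤ f ω)
    (hint : Integrable (fun ω => f ω ^ p) μ)
    (Δ : ℝ) (hΔ0 : 0 < Δ) (hΔ1 : Δ ≤ 1 / 2)
    (T : ℝ) (hT : 0 < T) (hTmeas : Δ ≤ (μ {ω | T < f ω}).toReal)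
    (N : ℕ) (x : Fin N → Ω)
    (hratio : ∀ t : ℝ, 0 < t → t < T → ∀ j : ℕ,
      Δ ≤ 2 ^ (-(j : ℝ)) * (μ {ω | t < f ω}).toReal →
      |empP x {ω | t < f ω} / (μ {ω | t < f ω}).toReal - 1| ≤ 2 ^ (-(j : ℝ) / 2)) :
    (∫ t in (0 : ℝ)..T, p * t ^ (p - 1) * empP x {ω | t < f ω}) ≥
      (∫ ω in {ω | f ω ≤ T}, f ω ^ p ∂μ) - errE μ f Δ p T := by
  have hw : Continuous fun t : ℝ => p * t ^ (p - 1) :=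
    continuous_const.mul (continuous_rpow_const (by linarith))
  have hPanti := measureReal_tail_antitone μ f
  have hP : IntervalIntegrable
      (fun t : ℝ => p * t ^ (p - 1) * (μ {ω | t < f ω}).toReal) volume 0 T :=
    hPanti.intervalIntegrable.continuousOn_mul hw.continuousOn
  have hsqrt : IntervalIntegrable
      (fun t : ℝ => p * t ^ (p - 1) * √(μ {ω | t < f ω}).toReal) volume 0 T :=
    (show Antitone fun t : ℝ => √(μ {ω | t < f ω}).toReal from
      fun _ _ hst => sqrt_le_sqrt (hPanti hst)).intervalIntegrable.continuousOn_mul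
        hw.continuousOn
  have hemp : IntervalIntegrable
      (fun t : ℝ => p * t ^ (p - 1) * empP x {ω | t < f ω}) volume 0 T :=
    (show Antitone fun t : ℝ => empP x {ω | t < f ω} from
      fun _ _ hst => empP_mono x fun _ hω => lt_of_le_of_lt hst hω).intervalIntegrable
        |>.continuousOn_mul hw.continuousOn
  have hmain : (∫ t in (0 : ℝ)..T, (p * t ^ (p - 1) * (μ {ω | t < f ω}).toReal -
      2 * √Δ * (p * t ^ (p - 1) * √(μ {ω | t < f ω}).toReal))) ≤
      ∫ t in (0 : ℝ)..T, p * t ^ (p - 1) * empP x {ω | t < f ω} := by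
    refine intervalIntegral.integral_mono_on_of_le_Ioo hT.le (hP.sub (hsqrt.const_mul _)) hemp
      fun t ht => ?_
    have hlow := sub_two_mul_sqrt_le_of_dyadic hΔ0 (hTmeas.trans (hPanti ht.2.le))
      (hratio t ht.1 ht.2)
    have hwt : 0 ≤ p * t ^ (p - 1) := mul_nonneg (by linarith) (rpow_nonneg ht.1.le _)
    linarith [mul_le_mul_of_nonneg_left hlow hwt]
  rw [intervalIntegral.integral_sub hP (hsqrt.const_mul _),
    intervalIntegral.integral_const_mul] at hmain
  have hcake := setIntegral_rpow_le_intervalIntegral_tail μ hp hmeas hnonneg hT.le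
  unfold errE
  linarith
end
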